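/- The inverse Mills ratio λ is Lipschitz continuous on ℝ with Lipschitz constant 1: for all real numbers a and b, |λ(a) - λ(b)| ≤ |a - b|. -/

import Mathlib

open MeasureTheory ProbabilityTheory Real

/-- The standard normal density φ(x) = (2π)^{-1/2} exp(-x²/2). -/
noncomputable def stdNormalPDF (x : ℝ) : ℝ :=
  (Real.sqrt (2 * Real.pi))⁻¹ * Real.exp (-x ^ 2 / 2)

/-- The standard normal distribution function Φ(x) = ∫_{-∞}^x φ(t) dt. -/
noncomputable def stdNormalCDF (x : ℝ) : ℝ :=
  ∫ t in Set.Iic x, stdNormalPDF t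

/-- The inverse Mills ratio λ(x) = φ(x)/Φ(x). -/
noncomputable def invMills (x : ℝ) : ℝ :=
  stdNormalPDF x / stdNormalCDF x

theorem stdNormalPDF_pos (x : ℝ) : 0 < stdNormalPDF x := by
  unfold stdNormalPDF; positivity

theorem integrable_pow_mul_stdNormalPDF (n : ℕ) :
    Integrable fun t : ℝ ↦ t ^ n * stdNormalPDF t := by
  have h := (integrable_rpow_mul_exp_neg_mul_sq (b := 1 / 2) (by norm_num) (s := n)
    (by linarith [n.cast_nonneg (α := ℝ)])).const_mul (Real.sqrt (2 * Real.pi))⁻¹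
  refine h.congr (.of_forall fun t ↦ ?_)
  simp only [stdNormalPDF, Real.rpow_natCast]
  rw [show -(1 / 2 : ℝ) * t ^ 2 = -t ^ 2 / 2 by ring]
  ring

theorem integrable_stdNormalPDF : Integrable stdNormalPDF := by
  simpa using integrable_pow_mul_stdNormalPDF 0

theorem integrable_mul_stdNormalPDF : Integrable fun t : ℝ ↦ t * stdNormalPDF t := by
  simpa using integrable_pow_mul_stdNormalPDF 1

theorem hasDerivAt_stdNormalPDF (x : ℝ) :
    HasDerivAt stdNormalPDF (-(x * stdNormalPDF x)) x := by
  have h : HasDerivAt (fun t : ℝ ↦ -t ^ 2 / 2) (-x) x := by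
    refine ((hasDerivAt_pow 2 x).neg.div_const 2).congr_deriv ?_
    ring
  refine (h.exp.const_mul (Real.sqrt (2 * Real.pi))⁻¹).congr_deriv ?_
  simp only [stdNormalPDF]
  ring

theorem continuous_stdNormalPDF : Continuous stdNormalPDF :=
  continuous_iff_continuousAt.2 fun x ↦ (hasDerivAt_stdNormalPDF x).continuousAt

/-- An integrable function with integrable derivative is recovered by integrating its derivative
over `(-∞, x]`. -/
theorem integral_Iic_of_hasDerivAt_of_integrable {f f' : ℝ → ℝ}
    (hderiv : ∀ t, HasDerivAt f (f' t) t) (hf' : Integrable f') (hf : Integrable f) (x : ℝ) :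
    ∫ t in Set.Iic x, f' t = f x := by
  have h := tendsto_zero_of_hasDerivAt_of_integrableOn_Iic (a := x) (fun t _ ↦ hderiv t)
    hf'.integrableOn hf.integrableOn
  simpa using integral_Iic_of_hasDerivAt_of_tendsto' (fun t _ ↦ hderiv t) hf'.integrableOn h

theorem integral_Iic_mul_stdNormalPDF (x : ℝ) :
    ∫ t in Set.Iic x, t * stdNormalPDF t = -stdNormalPDF x := by
  have h := integral_Iic_of_hasDerivAt_of_integrable hasDerivAt_stdNormalPDF
    integrable_mul_stdNormalPDF.neg integrable_stdNormalPDF x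
  rw [integral_neg] at h
  linarith

theorem integral_Iic_sq_mul_stdNormalPDF (x : ℝ) :
    ∫ t in Set.Iic x, t ^ 2 * stdNormalPDF t = stdNormalCDF x - x * stdNormalPDF x := by
  have hderiv (t : ℝ) : HasDerivAt (fun t ↦ t * stdNormalPDF t)
      (stdNormalPDF t - t ^ 2 * stdNormalPDF t) t := by
    refine ((hasDerivAt_id t).mul (hasDerivAt_stdNormalPDF t)).congr_deriv ?_
    simp only [id]
    ring
  have h := integral_Iic_of_hasDerivAt_of_integrable hderiv
    (integrable_stdNormalPDF.sub (integrable_pow_mul_stdNormalPDF 2))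
    integrable_mul_stdNormalPDF x
  rw [integral_sub integrable_stdNormalPDF.integrableOn
    (integrable_pow_mul_stdNormalPDF 2).integrableOn] at h
  simp only [stdNormalCDF]
  linarith

theorem stdNormalCDF_pos (x : ℝ) : 0 < stdNormalCDF x := by
  have hsupp : Function.support stdNormalPDF = Set.univ :=
    Set.eq_univ_of_forall fun t ↦ (stdNormalPDF_pos t).ne'
  rw [stdNormalCDF, setIntegral_pos_iff_support_of_nonneg_ae
    (.of_forall fun t ↦ (stdNormalPDF_pos t).le) integrable_stdNormalPDF.integrableOn]
  simp [hsupp]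

theorem hasDerivAt_stdNormalCDF (x : ℝ) : HasDerivAt stdNormalCDF (stdNormalPDF x) x := by
  have h := (intervalIntegral.integral_hasDerivAt_right
    (integrable_stdNormalPDF.intervalIntegrable (a := 0) (b := x))
    (continuous_stdNormalPDF.stronglyMeasurableAtFilter _ _)
    continuous_stdNormalPDF.continuousAt).const_add (stdNormalCDF 0)
  refine h.congr_of_eventuallyEq (.of_forall fun y ↦ ?_)
  have := intervalIntegral.integral_Iic_sub_Iic (a := 0) (b := y)
    integrable_stdNormalPDF.integrableOn integrable_stdNormalPDF.integrableOn
  simp only [stdNormalCDF]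
  linarith

theorem hasDerivAt_invMills (x : ℝ) :
    HasDerivAt invMills (-(invMills x * (x + invMills x))) x := by
  have hpos := (stdNormalCDF_pos x).ne'
  refine ((hasDerivAt_stdNormalPDF x).div (hasDerivAt_stdNormalCDF x) hpos).congr_deriv ?_
  simp only [invMills]
  field_simp
  ring

theorem invMills_pos (x : ℝ) : 0 < invMills x :=
  div_pos (stdNormalPDF_pos x) (stdNormalCDF_pos x)

theorem invMills_mul_stdNormalCDF (x : ℝ) : invMills x * stdNormalCDF x = stdNormalPDF x :=
  div_mul_cancel₀ _ (stdNormalCDF_pos x).ne'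

/-- The mean of a standard normal variable conditioned on `(-∞, x]` is `-invMills x`, so it is at
most `x`. -/
theorem add_invMills_nonneg (x : ℝ) : 0 ≤ x + invMills x := by
  have h : 0 ≤ ∫ t in Set.Iic x, (x * stdNormalPDF t - t * stdNormalPDF t) :=
    setIntegral_nonneg measurableSet_Iic fun t ht ↦ by
      rw [← sub_mul]
      exact mul_nonneg (sub_nonneg.2 ht) (stdNormalPDF_pos t).le
  rw [integral_sub (integrable_stdNormalPDF.const_mul x).integrableOn
    integrable_mul_stdNormalPDF.integrableOn, integral_const_mul,
    integral_Iic_mul_stdNormalPDF, ← stdNormalCDF, ← invMills_mul_stdNormalCDF] at h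
  refine nonneg_of_mul_nonneg_left ?_ (stdNormalCDF_pos x)
  linarith

/-- The variance of a standard normal variable conditioned on `(-∞, x]` is
`1 - invMills x * (x + invMills x)`, and it is nonnegative. -/
theorem invMills_mul_add_invMills_le_one (x : ℝ) : invMills x * (x + invMills x) ≤ 1 := by
  set l := invMills x with hl
  have h : 0 ≤ ∫ t in Set.Iic x, (t ^ 2 * stdNormalPDF t + 2 * l * (t * stdNormalPDF t) +
      l ^ 2 * stdNormalPDF t) :=
    setIntegral_nonneg measurableSet_Iic fun t _ ↦ by
      have := mul_nonneg (sq_nonneg (t + l)) (stdNormalPDF_pos t).le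
      linarith
  have h₁ := integrable_mul_stdNormalPDF.const_mul (2 * l)
  have h₂ := integrable_pow_mul_stdNormalPDF 2
  rw [integral_add (h₂.fun_add h₁).integrableOn (integrable_stdNormalPDF.const_mul _).integrableOn,
    integral_add h₂.integrableOn h₁.integrableOn, integral_const_mul, integral_const_mul,
    integral_Iic_mul_stdNormalPDF, integral_Iic_sq_mul_stdNormalPDF, ← stdNormalCDF,
    ← invMills_mul_stdNormalCDF, ← hl] at h
  have : 0 ≤ (1 - l * (x + l)) * stdNormalCDF x := by linarith
  linarith [nonneg_of_mul_nonneg_left this (stdNormalCDF_pos x)]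

/-- The inverse Mills ratio is 1-Lipschitz:
`|λ(a) - λ(b)| ≤ |a - b|` for all reals `a`, `b`. -/
theorem invMills_lipschitz (a b : ℝ) :
    |invMills a - invMills b| ≤ |a - b| := by
  have h := Convex.norm_image_sub_le_of_norm_hasDerivWithin_le (C := 1)
    (fun x _ ↦ (hasDerivAt_invMills x).hasDerivWithinAt) (fun x _ ↦ ?_) convex_univ
    (Set.mem_univ b) (Set.mem_univ a)
  · simpa using h
  · rw [norm_neg, Real.norm_eq_abs,
      abs_of_nonneg (mul_nonneg (invMills_pos x).le (add_invMills_nonneg x))]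
    exact invMills_mul_add_invMills_le_one x
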